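/- Let r₀,r₁,α₀,α₁ be reals with 2≤r₁≤r₀, 0≤α₀≤α₁<1 and (r₀−2α₀)/(1−α₀) = (r₁−2α₁)/(1−α₁) (equal traces). If a cubic graph G admits an (r₀,α₀)-flow then G admits an (r₁,α₁)-flow. -/

import Mathlib

open Finset
open scoped Classical

namespace BEF

variable {V : Type*}

/-- An orientation of a simple graph: each edge gets exactly one direction. -/
structure Orientation (G : SimpleGraph V) where
  dir : V → V → Prop
  adj_of_dir : ∀ u v, dir u v → G.Adj u v
  dir_iff_not : ∀ u v, G.Adj u v → (dir u v ↔ ¬ dir v u)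

/-- Net outflow (excess) of `f` at vertex `x` in orientation `D`. -/
noncomputable def excess [Fintype V] {G : SimpleGraph V}
    (D : Orientation G) (f : Sym2 V → ℝ) (x : V) : ℝ :=
  (∑ y : V, if D.dir x y then f s(x, y) else 0)
    - (∑ y : V, if D.dir y x then f s(x, y) else 0)

/-- `f` is an `(r, α)`-bounded-excess flow in the orientation `D` of `G`. -/
def IsBEFlow [Fintype V] {G : SimpleGraph V}
    (D : Orientation G) (r α : ℝ) (f : Sym2 V → ℝ) : Prop :=
  (∀ e ∈ G.edgeSet, 1 ≤ f e ∧ f e ≤ r - 1) ∧ ∀ x : V, |excess D f x| ≤ α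

/-- `G` admits an `(r, α)`-flow. -/
def HasFlow [Fintype V] (G : SimpleGraph V) (r α : ℝ) : Prop :=
  ∃ D : Orientation G, ∃ f : Sym2 V → ℝ, IsBEFlow D r α f

/-- Outdegree of a vertex in an orientation. -/
noncomputable def outDeg {G : SimpleGraph V} (D : Orientation G) (x : V) : ℕ :=
  {y | D.dir x y}.ncard

/-- A cubic graph: every vertex has exactly 3 neighbours. -/
def IsCubic (G : SimpleGraph V) : Prop :=
  ∀ v : V, (G.neighborSet v).ncard = 3

/-- A bisection: a partition of the vertex set into two parts of equal size. -/
def IsBisection [Fintype V] (V₁ V₂ : Set V) : Prop :=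
  Disjoint V₁ V₂ ∧ V₁ ∪ V₂ = Set.univ ∧ V₁.ncard = V₂.ncard

/-- The bisection `(V₁, V₂)` of `G` is orientable. -/
def Orientable (G : SimpleGraph V) (V₁ V₂ : Set V) : Prop :=
  ∃ D : Orientation G, (∀ v ∈ V₁, outDeg D v = 1) ∧ (∀ v ∈ V₂, outDeg D v = 2)

/-- `d(A)`: the number of edges of `G` with exactly one endvertex in `A`. -/
noncomputable def cutCard (G : SimpleGraph V) (A : Set V) : ℕ :=
  {e ∈ G.edgeSet | ∃ u ∈ A, ∃ v ∉ A, e = s(u, v)}.ncard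

/-- `Δ(A) = | |V₂ ∩ A| - |V₁ ∩ A| |` (as an integer). -/
noncomputable def disc (V₁ V₂ A : Set V) : ℤ :=
  |((V₂ ∩ A).ncard : ℤ) - ((V₁ ∩ A).ncard : ℤ)|

/-- Every connected component of the subgraph induced on `S` is a tree on
at most `k - 2` vertices. -/
def WeakSide (G : SimpleGraph V) (k : ℕ) (S : Set V) : Prop :=
  (G.induce S).IsAcyclic ∧
    ∀ c : (G.induce S).ConnectedComponent, c.supp.ncard ≤ k - 2

/-- A `k`-weak bisection. -/
def KWeak [Fintype V] (G : SimpleGraph V) (k : ℕ) (V₁ V₂ : Set V) : Prop :=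
  IsBisection V₁ V₂ ∧ WeakSide G k V₁ ∧ WeakSide G k V₂

/-- A balanced orientation: every outdegree is 1 or 2. -/
def Balanced {G : SimpleGraph V} (D : Orientation G) : Prop :=
  ∀ v : V, outDeg D v = 1 ∨ outDeg D v = 2

/-- The excess as a difference of sums over the out-neighbours and the in-neighbours. -/
lemma excess_eq_sum_filter [Fintype V] {G : SimpleGraph V} (D : Orientation G)
    (f : Sym2 V → ℝ) (x : V) :
    excess D f x = ∑ y with D.dir x y, f s(x, y) - ∑ y with D.dir y x, f s(x, y) := by
  simp only [excess, Finset.sum_filter]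

lemma excess_one [Fintype V] {G : SimpleGraph V} (D : Orientation G) (x : V) :
    excess D (fun _ => 1) x = (#{y | D.dir x y} : ℝ) - #{y | D.dir y x} := by
  simp [excess_eq_sum_filter]

lemma excess_affine [Fintype V] {G : SimpleGraph V} (D : Orientation G)
    (f : Sym2 V → ℝ) (a b : ℝ) (x : V) :
    excess D (fun e => a * f e + b) x = a * excess D f x + b * excess D (fun _ => 1) x := by
  simp only [excess_eq_sum_filter, Finset.sum_add_distrib, ← Finset.mul_sum,
    Finset.sum_const, nsmul_eq_mul]
  ring

lemma card_out_add_card_in [Fintype V] {G : SimpleGraph V} (hG : IsCubic G)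
    (D : Orientation G) (x : V) :
    #{y | D.dir x y} + #{y | D.dir y x} = 3 := by
  have hdisj : Disjoint (univ.filter fun y => D.dir x y) (univ.filter fun y => D.dir y x) := by
    rw [Finset.disjoint_filter]
    intro y _ h
    exact (D.dir_iff_not x y (D.adj_of_dir x y h)).1 h
  rw [← Finset.card_union_of_disjoint hdisj, ← hG x, ← Set.ncard_coe_finset]
  congr 1
  ext y
  simp only [coe_union, coe_filter, mem_univ, true_and, Set.mem_union, Set.mem_ofPred_eq,
    SimpleGraph.mem_neighborSet]
  constructor
  · rintro (h | h)
    · exact D.adj_of_dir x y h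
    · exact (D.adj_of_dir y x h).symm
  · intro h
    have := D.dir_iff_not x y h
    tauto

/-- In a cubic graph, an orientation carrying an `(r, α)`-flow with `α < 3` has in- and outdegree
differing by at most one at every vertex. -/
lemma abs_excess_one_le [Fintype V] {G : SimpleGraph V} (hG : IsCubic G) {D : Orientation G}
    {f : Sym2 V → ℝ} {r α : ℝ} (hα : α < 3) (hf : IsBEFlow D r α f) (x : V) :
    |excess D (fun _ => 1) x| ≤ 1 := by
  have hcard := card_out_add_card_in hG D x
  have hx := abs_le.1 (hf.2 x)
  have hout : (#{y | D.dir x y} : ℝ) ≤ ∑ y with D.dir x y, f s(x, y) := by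
    simpa using Finset.card_nsmul_le_sum (univ.filter fun y => D.dir x y)
      (fun y => f s(x, y)) 1 fun y hy =>
        (hf.1 s(x, y) (D.adj_of_dir x y (Finset.mem_filter.1 hy).2)).1
  have hin : (#{y | D.dir y x} : ℝ) ≤ ∑ y with D.dir y x, f s(x, y) := by
    simpa using Finset.card_nsmul_le_sum (univ.filter fun y => D.dir y x)
      (fun y => f s(x, y)) 1 fun y hy =>
        (hf.1 s(x, y) (D.adj_of_dir y x (Finset.mem_filter.1 hy).2).symm).1
  rw [excess_eq_sum_filter] at hx
  have hout_ne : #{y | D.dir x y} ≠ 0 := by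
    intro h
    have h3 : #{y | D.dir y x} = 3 := by omega
    rw [h3] at hin
    rw [Finset.card_eq_zero.1 h] at hx
    norm_num at hx hin
    linarith
  have hin_ne : #{y | D.dir y x} ≠ 0 := by
    intro h
    have h3 : #{y | D.dir x y} = 3 := by omega
    rw [h3] at hout
    rw [Finset.card_eq_zero.1 h] at hx
    norm_num at hx hout
    linarith
  have hint : |(#{y | D.dir x y} : ℤ) - #{y | D.dir y x}| ≤ 1 := by
    rw [abs_le]
    omega
  rw [excess_one]
  exact_mod_cast hint

/-- among points of equal trace, the one with smaller `α` is stronger. -/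
theorem stmt4 [Fintype V] (G : SimpleGraph V) (hG : IsCubic G)
    (r₀ r₁ α₀ α₁ : ℝ) (hr₁ : 2 ≤ r₁) (hr : r₁ ≤ r₀)
    (hα₀ : 0 ≤ α₀) (hα : α₀ ≤ α₁) (hα₁ : α₁ < 1)
    (htr : (r₀ - 2 * α₀) / (1 - α₀) = (r₁ - 2 * α₁) / (1 - α₁))
    (h : HasFlow G r₀ α₀) : HasFlow G r₁ α₁ := by
  obtain ⟨D, f, hf⟩ := h
  have h0 : 0 < 1 - α₀ := by linarith
  have h1 : 0 < 1 - α₁ := by linarith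
  obtain ⟨l, hl⟩ : ∃ l, l = (1 - α₁) / (1 - α₀) := ⟨_, rfl⟩
  have hl0 : 0 ≤ l := hl ▸ by positivity
  have hl1 : l ≤ 1 := by
    rw [hl, div_le_one h0]
    linarith
  have hlα : l * (1 - α₀) = 1 - α₁ := by
    rw [hl, div_mul_cancel₀ _ h0.ne']
  have hlr : l * (r₀ - 2) = r₁ - 2 := by
    rw [div_eq_div_iff h0.ne' h1.ne'] at htr
    rw [hl]
    field_simp
    linarith
  refine ⟨D, fun e => l * f e + (1 - l), fun e he => ?_, fun x => ?_⟩
  · obtain ⟨hlow, hup⟩ := hf.1 e he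
    constructor <;> nlinarith
  · have hx := abs_excess_one_le hG (by linarith) hf x
    rw [excess_affine]
    calc |l * excess D f x + (1 - l) * excess D (fun _ => 1) x|
        ≤ |l * excess D f x| + |(1 - l) * excess D (fun _ => 1) x| := abs_add_le _ _
      _ = l * |excess D f x| + (1 - l) * |excess D (fun _ => 1) x| := by
          rw [abs_mul, abs_mul, abs_of_nonneg hl0, abs_of_nonneg (sub_nonneg.2 hl1)]
      _ ≤ l * α₀ + (1 - l) * 1 :=
          add_le_add (mul_le_mul_of_nonneg_left (hf.2 x) hl0)
            (mul_le_mul_of_nonneg_left hx (sub_nonneg.2 hl1))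
      _ = α₁ := by linarith

end BEF
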